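/- Under the even-case construction, C(π_A) ≥ (k+1-ε) · min_π C(π), where the minimum is over all bijections π of {1,...,k}. -/

import Mathlib

/-!
Even-case construction: k ≥ 2 even, 0 < ε ≤ 1.  Servers s_1,...,s_k at
positions 0,...,k-1 (s_i at position i-1).  ε_i = (ε/8)·2^(i-k) for i < k and
ε_k = 1/2.  Requests (1-indexed): for j = 1,...,k/2,
r_{2j-1} = (k/2 + j - 1) - 1/2 - ε_{2j-1},  r_{2j} = (k/2 - j) - 1/2 + ε_{2j}.
A matching is a function f : ℕ → ℕ sending each request index i ∈ {1,...,k} to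
a server index f i ∈ {1,...,k} (at position f i - 1); its cost is
C(f) = ∑_{i=1}^k |r_i - (f i - 1)|.
-/

/-- `ε_i`: equals `(ε/8)·2^(i-k)` for `i < k` and `1/2` for `i = k`. -/
noncomputable def eps (k : ℕ) (ε : ℝ) (i : ℕ) : ℝ :=
  if i = k then 1 / 2 else ε / 8 * (2 : ℝ) ^ ((i : ℤ) - (k : ℤ))

/-- The request `r_i` (1-indexed, `1 ≤ i ≤ k`): writing `i = 2j-1` or `i = 2j`,
`r_{2j-1} = (k/2 + j - 1) - 1/2 - ε_{2j-1}` and `r_{2j} = (k/2 - j) - 1/2 + ε_{2j}`. -/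
noncomputable def req (k : ℕ) (ε : ℝ) (i : ℕ) : ℝ :=
  if i % 2 = 1 then ((k : ℝ) / 2 + (((i + 1) / 2 : ℕ) : ℝ) - 1) - 1 / 2 - eps k ε i
  else ((k : ℝ) / 2 - ((i / 2 : ℕ) : ℝ)) - 1 / 2 + eps k ε i

/-- Cost of the matching sending request `i` to server `f i` (position `f i - 1`). -/
noncomputable def cost (k : ℕ) (ε : ℝ) (f : ℕ → ℕ) : ℝ :=
  ∑ i ∈ Finset.Icc 1 k, |req k ε i - ((f i : ℝ) - 1)|

/-- The permutation algorithm's matching `π_A`: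
`π_A(2j-1) = k/2 - j + 1`, `π_A(2j) = k/2 + j`. -/
def piA (k : ℕ) (i : ℕ) : ℕ :=
  if i % 2 = 1 then k / 2 - (i + 1) / 2 + 1 else k / 2 + i / 2

/-- The offline matching `π_B`: `π_B(2j-1) = k/2 + j`, `π_B(2j) = k/2 - j + 1`. -/
def piB (k : ℕ) (i : ℕ) : ℕ :=
  if i % 2 = 1 then k / 2 + (i + 1) / 2 else k / 2 - i / 2 + 1

theorem eps_pos {k : ℕ} {ε : ℝ} (hε : 0 < ε) (i : ℕ) : 0 < eps k ε i := by
  unfold eps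
  split_ifs <;> positivity

theorem eps_self (k : ℕ) (ε : ℝ) : eps k ε k = 1 / 2 := by
  simp [eps]

theorem sum_Icc_two_zpow_le (n : ℕ) :
    ∑ i ∈ Finset.Icc 1 n, (2 : ℝ) ^ (i : ℤ) ≤ 2 ^ ((n + 1 : ℕ) : ℤ) := by
  simp only [zpow_natCast]
  induction n with
  | zero => simp
  | succ n ih =>
    rw [Finset.sum_Icc_succ_top (by omega), pow_succ _ (n + 1)]
    linarith

theorem sum_Icc_eps_le {ε : ℝ} (hε : 0 < ε) (n : ℕ) :
    ∑ i ∈ Finset.Icc 1 n, eps (n + 1) ε i ≤ ε / 8 := by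
  have heps : ∀ i ∈ Finset.Icc 1 n,
      eps (n + 1) ε i = ε / 8 * ((2 : ℝ) ^ ((n + 1 : ℕ) : ℤ))⁻¹ * (2 : ℝ) ^ (i : ℤ) := by
    intro i hi
    rw [Finset.mem_Icc] at hi
    rw [eps, if_neg (by omega), zpow_sub₀ two_ne_zero]
    ring
  rw [Finset.sum_congr rfl heps, ← Finset.mul_sum]
  calc ε / 8 * ((2 : ℝ) ^ ((n + 1 : ℕ) : ℤ))⁻¹ * ∑ i ∈ Finset.Icc 1 n, (2 : ℝ) ^ (i : ℤ)
      ≤ ε / 8 * ((2 : ℝ) ^ ((n + 1 : ℕ) : ℤ))⁻¹ * (2 : ℝ) ^ ((n + 1 : ℕ) : ℤ) := by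
        gcongr
        exact sum_Icc_two_zpow_le n
    _ = ε / 8 := by
        rw [mul_assoc, inv_mul_cancel₀ (by positivity), mul_one]

theorem bijOn_piB {k : ℕ} (hke : Even k) :
    Set.BijOn (piB k) (Set.Icc 1 k) (Set.Icc 1 k) := by
  obtain ⟨m, rfl⟩ := hke
  refine ⟨fun i hi => ?_, fun i hi j hj hij => ?_, fun y hy => ?_⟩
  · simp only [Set.mem_Icc, piB] at *
    split_ifs <;> omega
  · simp only [Set.mem_Icc, piB] at *
    split_ifs at hij <;> omega
  · simp only [Set.mem_Icc, Set.mem_image, piB] at *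
    by_cases h : m < y
    · refine ⟨2 * (y - m) - 1, by omega, ?_⟩
      rw [if_pos (by omega)]
      omega
    · refine ⟨2 * (m - y + 1), by omega, ?_⟩
      rw [if_neg (by omega)]
      omega

theorem abs_req_sub_piA_ge {k : ℕ} (hke : Even k) (ε : ℝ) {i : ℕ} (hi : i ∈ Finset.Icc 1 k) :
    (i : ℝ) - 1 / 2 - eps k ε i ≤ |req k ε i - ((piA k i : ℝ) - 1)| := by
  obtain ⟨m, rfl⟩ := hke
  rw [Finset.mem_Icc] at hi
  rcases Nat.even_or_odd' i with ⟨j, rfl | rfl⟩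
  · refine le_trans (le_of_eq ?_) (neg_le_abs _)
    rw [req, piA, if_neg (by omega), if_neg (by omega), show 2 * j / 2 = j by omega,
      show (m + m) / 2 = m by omega]
    push_cast
    ring
  · refine le_trans (le_of_eq ?_) (le_abs_self _)
    rw [req, piA, if_pos (by omega), if_pos (by omega), show (2 * j + 1 + 1) / 2 = j + 1 by omega,
      show (m + m) / 2 - (j + 1) + 1 = m - j by omega, Nat.cast_sub (by omega)]
    push_cast
    ring

theorem req_sub_piB {k : ℕ} (hke : Even k) (ε : ℝ) {i : ℕ} (hi : i ∈ Finset.Icc 1 k) :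
    req k ε i - ((piB k i : ℝ) - 1) =
      if i % 2 = 1 then -(1 / 2 + eps k ε i) else -(1 / 2 - eps k ε i) := by
  obtain ⟨m, rfl⟩ := hke
  rw [Finset.mem_Icc] at hi
  rcases Nat.even_or_odd' i with ⟨j, rfl | rfl⟩
  · rw [req, piB, if_neg (by omega), if_neg (by omega), if_neg (by omega),
      show 2 * j / 2 = j by omega, show (m + m) / 2 = m by omega, Nat.cast_add (m - j),
      Nat.cast_sub (by omega)]
    push_cast
    ring
  · rw [req, piB, if_pos (by omega), if_pos (by omega), if_pos (by omega),
      show (2 * j + 1 + 1) / 2 = j + 1 by omega, show (m + m) / 2 = m by omega]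
    push_cast
    ring

theorem abs_req_sub_piB_le {k : ℕ} (hke : Even k) {ε : ℝ} (hε : 0 < ε) {i : ℕ}
    (hi : i ∈ Finset.Icc 1 k) :
    |req k ε i - ((piB k i : ℝ) - 1)| ≤ 1 / 2 + eps k ε i := by
  have h := eps_pos (k := k) hε i
  rw [req_sub_piB hke ε hi, abs_le]
  split_ifs <;> constructor <;> linarith

theorem sum_Icc_sub_half (n : ℕ) :
    ∑ i ∈ Finset.Icc 1 n, ((i : ℝ) - 1 / 2) = (n : ℝ) ^ 2 / 2 := by
  induction n with
  | zero => simp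
  | succ n ih =>
    rw [Finset.sum_Icc_succ_top (by omega), ih]
    push_cast
    ring

theorem cost_piA_ge {n : ℕ} (hke : Even (n + 1)) {ε : ℝ} (hε : 0 < ε) :
    (n : ℝ) * (n + 2) / 2 - ε / 8 ≤ cost (n + 1) ε (piA (n + 1)) := by
  have h := Finset.sum_le_sum fun i hi => abs_req_sub_piA_ge hke ε (i := i) hi
  rw [Finset.sum_sub_distrib, sum_Icc_sub_half,
    Finset.sum_Icc_succ_top (f := eps (n + 1) ε) (by omega), eps_self] at h
  have hs := sum_Icc_eps_le hε n
  push_cast at h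
  unfold cost
  linarith

theorem cost_piB_le {n : ℕ} (hke : Even (n + 1)) {ε : ℝ} (hε : 0 < ε) :
    cost (n + 1) ε (piB (n + 1)) ≤ (n : ℝ) / 2 + ε / 8 := by
  have hlast : |req (n + 1) ε (n + 1) - ((piB (n + 1) (n + 1) : ℝ) - 1)| = 0 := by
    rw [req_sub_piB hke ε (by simp), if_neg (by rw [Nat.even_iff.mp hke]; simp), eps_self]
    simp
  have h : ∑ i ∈ Finset.Icc 1 n, |req (n + 1) ε i - ((piB (n + 1) i : ℝ) - 1)| ≤
      ∑ i ∈ Finset.Icc 1 n, (1 / 2 + eps (n + 1) ε i) :=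
    Finset.sum_le_sum fun i hi => abs_req_sub_piB_le hke hε
      (Finset.Icc_subset_Icc_right (Nat.le_succ n) hi)
  rw [Finset.sum_add_distrib, Finset.sum_const, Nat.card_Icc, nsmul_eq_mul,
    Nat.add_sub_cancel] at h
  have hs := sum_Icc_eps_le hε n
  rw [cost, Finset.sum_Icc_succ_top (by omega), hlast]
  linarith

/-- Even case: C(π_A) ≥ (k+1-ε) · min over all bijections π of {1,...,k} of C(π). -/
theorem even_ratio (k : ℕ) (hk : 2 ≤ k) (hke : Even k)
    (ε : ℝ) (hε : 0 < ε) (hε1 : ε ≤ 1) :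
    cost k ε (piA k) ≥
      ((k : ℝ) + 1 - ε) *
        sInf {c : ℝ | ∃ g : ℕ → ℕ,
          Set.BijOn g (Set.Icc 1 k) (Set.Icc 1 k) ∧ c = cost k ε g} := by
  have hle : sInf {c : ℝ | ∃ g : ℕ → ℕ,
      Set.BijOn g (Set.Icc 1 k) (Set.Icc 1 k) ∧ c = cost k ε g} ≤ cost k ε (piB k) := by
    refine csInf_le ⟨0, ?_⟩ ⟨piB k, bijOn_piB hke, rfl⟩
    rintro _ ⟨g, -, rfl⟩
    exact Finset.sum_nonneg fun i _ => abs_nonneg _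
  obtain ⟨n, rfl⟩ : ∃ n, k = n + 1 := ⟨k - 1, by omega⟩
  have hn : (1 : ℝ) ≤ n := by exact_mod_cast (by omega : 1 ≤ n)
  have hA := cost_piA_ge hke hε
  have hB := hle.trans (cost_piB_le hke hε)
  have hmul := mul_le_mul_of_nonneg_left hB
    (show (0 : ℝ) ≤ ((n + 1 : ℕ) : ℝ) + 1 - ε by push_cast; linarith)
  refine ge_iff_le.mpr (hmul.trans (le_trans ?_ hA))
  push_cast
  nlinarith [mul_nonneg hε.le (sub_nonneg.mpr hn), mul_pos hε hε]
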